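/- arXiv:2203.08466 — 5 statements merged into one kernel-verified Lean document; each statement's English description precedes it below -/
import Mathlib

section
/- Let G be a compactly generated Hausdorff semitopological group with generating set Γ, and let F be any finite subset of G. Then there is an integer n > 1 such that for every g ∈ G with |g| ≥ n, there is an element t ∈ G with |t| = n and Ft ⊆ K(g). -/
/-!
STATEMENT 5. Let `G` be a compactly generated Hausdorff semitopological group with
generating set `Γ` and `F ⊆ G` finite. Then there is `n > 1` such that for every `g ∈ G`
with `|g| ≥ n` there is `t ∈ G` with `|t| = n` and `Ft ⊆ K(g)`.
-/

universe u

open Pointwise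

/-- The `Γ`-length of `g` : the least `r ≥ 1` with `g ∈ Γ^r`. -/
noncomputable def gamLen {G : Type u} [Group G] (Γ : Set G) (g : G) : ℕ :=
  sInf {r : ℕ | 0 < r ∧ g ∈ Γ ^ r}

/-- `K(g) = Γ^{|g|-1} · g`. -/
noncomputable def KSet {G : Type u} [Group G] (Γ : Set G) (g : G) : Set G :=
  Γ ^ (gamLen Γ g - 1) * {g}

/-- `Γ` is a generating set of `G`. -/
def IsGenSet {G : Type u} [Group G] [TopologicalSpace G] (Γ : Set G) : Prop :=
  IsCompact Γ ∧ (1 : G) ∈ Γ ∧ Γ⁻¹ = Γ ∧ ∀ g : G, ∃ r : ℕ, 1 ≤ r ∧ g ∈ Γ ^ r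

theorem gamLen_mem {G : Type u} [Group G] {Γ : Set G} {g : G}
    (h : ∃ r : ℕ, 1 ≤ r ∧ g ∈ Γ ^ r) : 0 < gamLen Γ g ∧ g ∈ Γ ^ gamLen Γ g :=
  Nat.sInf_mem (s := {r : ℕ | 0 < r ∧ g ∈ Γ ^ r}) h

theorem gamLen_le {G : Type u} [Group G] {Γ : Set G} {g : G} {r : ℕ}
    (hr : 0 < r) (h : g ∈ Γ ^ r) : gamLen Γ g ≤ r :=
  Nat.sInf_le ⟨hr, h⟩

/-- A finite set lies in a single power of a generating set. -/
theorem exists_finite_subset_pow {G : Type u} [Group G] {Γ : Set G} (h1 : (1 : G) ∈ Γ)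
    (hgen : ∀ g : G, ∃ r : ℕ, 1 ≤ r ∧ g ∈ Γ ^ r) {F : Set G} (hF : F.Finite) :
    ∃ N : ℕ, 1 ≤ N ∧ F ⊆ Γ ^ N := by
  induction F, hF using Set.Finite.induction_on with
  | empty => exact ⟨1, le_rfl, Set.empty_subset _⟩
  | @insert a s _ _ ih =>
    obtain ⟨N, hN, hs⟩ := ih
    obtain ⟨r, _, ha⟩ := hgen a
    refine ⟨max r N, le_max_of_le_right hN, Set.insert_subset ?_ ?_⟩
    · exact Set.pow_subset_pow_right h1 (le_max_left r N) ha
    · exact hs.trans (Set.pow_subset_pow_right h1 (le_max_right r N))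

/-- An element of length at least `n` ends in an element of length exactly `n`. -/
theorem exists_suffix_gamLen_eq {G : Type u} [Group G] {Γ : Set G} {g : G}
    (hg : ∃ r : ℕ, 1 ≤ r ∧ g ∈ Γ ^ r) {n : ℕ} (hn : 0 < n) (hng : n ≤ gamLen Γ g) :
    ∃ s ∈ Γ ^ (gamLen Γ g - n), ∃ t : G, gamLen Γ t = n ∧ s * t = g := by
  have hmem := (gamLen_mem hg).2
  rw [← Nat.sub_add_cancel hng, pow_add] at hmem
  obtain ⟨s, hs, t, ht, hst⟩ := Set.mem_mul.1 hmem
  refine ⟨s, hs, t, le_antisymm (gamLen_le hn ht) ?_, hst⟩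
  obtain ⟨hpos, htmem⟩ := gamLen_mem ⟨n, hn, ht⟩
  have hprod : g ∈ Γ ^ (gamLen Γ g - n + gamLen Γ t) := by
    have := Set.mul_mem_mul hs htmem
    rwa [hst, ← pow_add] at this
  have := gamLen_le (by omega) hprod
  omega

theorem stmt_5 {G : Type u} [Group G] [TopologicalSpace G] [T2Space G] [ContinuousMul G]
    (Γ : Set G) (hΓ : IsGenSet Γ)
    (F : Set G) (hF : F.Finite) :
    ∃ n : ℕ, 1 < n ∧ ∀ g : G, n ≤ gamLen Γ g →
      ∃ t : G, gamLen Γ t = n ∧ ∀ f ∈ F, f * t ∈ KSet Γ g := by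
  obtain ⟨-, h1, hinv, hgen⟩ := hΓ
  obtain ⟨N, hN, hFN⟩ := exists_finite_subset_pow h1 hgen hF
  refine ⟨N + 1, by omega, fun g hg => ?_⟩
  obtain ⟨s, hs, t, ht, hst⟩ := exists_suffix_gamLen_eq (hgen g) N.succ_pos hg
  refine ⟨t, ht, fun f hf => ?_⟩
  have hs' : s⁻¹ ∈ Γ ^ (gamLen Γ g - (N + 1)) := by
    rw [← hinv, inv_pow]
    exact Set.inv_mem_inv.2 (by rwa [hinv])
  have hprod := Set.mul_mem_mul (hFN hf) hs'
  rw [← pow_add, show N + (gamLen Γ g - (N + 1)) = gamLen Γ g - 1 by omega] at hprod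
  refine Set.mem_mul.2 ⟨f * s⁻¹, hprod, g, rfl, ?_⟩
  rw [← hst]
  group
end

section
/- Let (G,X) be a flow, where G is compactly generated with generating set Γ, and let x ∈ X. If x is an almost periodic point of (G,X), then x is Γ-recurrent of type II. -/
/-!
STATEMENT 6. For a flow (G,X) with `G` compactly generated with generating set `Γ`:
every almost periodic point of (G,X) is `Γ`-recurrent of type II.
-/

universe u

open Pointwise MulAction

/-- `A` is syndetic in `G` : `G = KA` for some compact `K ⊆ G`. -/
def Syndetic {G : Type u} [Group G] [TopologicalSpace G] (A : Set G) : Prop :=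
  ∃ K : Set G, IsCompact K ∧ K * A = Set.univ

/-- `x` is an almost periodic point : `N_G(x,U) = {t | t • x ∈ U}` is syndetic for every
neighborhood `U` of `x`. -/
def IsAPpt (G : Type u) {X : Type u} [Group G] [TopologicalSpace G] [TopologicalSpace X]
    [MulAction G X] (x : X) : Prop :=
  ∀ U ∈ nhds x, Syndetic {t : G | t • x ∈ U}

/-- `x` is `Γ`-recurrent of type II : for every neighborhood `U` of `x` and every net
`{g_i}` in `G` with `|g_i| → ∞` there are `n ≥ 1`, a subnet `{g_{φ k}}` and elements
`c k ∈ K(g_{φ k})` with `(c k) • x ∈ U` and `|c k| ≤ n`. -/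
def RecII {G X : Type u} [Group G] [TopologicalSpace X] [MulAction G X]
    (Γ : Set G) (x : X) : Prop :=
  ∀ U ∈ nhds x, ∀ (ι : Type u) [Preorder ι] [Nonempty ι] [IsDirected ι (· ≤ ·)],
    ∀ g : ι → G, (∀ n : ℕ, ∃ i₀, ∀ i, i₀ ≤ i → n ≤ gamLen Γ (g i)) →
      ∃ n : ℕ, 1 ≤ n ∧
        ∃ (κ : Type u) (pk : Preorder κ), Nonempty κ ∧ IsDirected κ pk.le ∧
          ∃ (φ : κ → ι) (c : κ → G),
            (∀ i, ∃ k₀, ∀ k, pk.le k₀ k → i ≤ φ k) ∧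
            (∀ k, c k ∈ KSet Γ (g (φ k)) ∧ c k • x ∈ U ∧ gamLen Γ (c k) ≤ n)

/-- Every orbit in the orbit closure of an almost periodic point returns to each neighborhood
of that point. -/
theorem IsAPpt.exists_smul_mem {G X : Type u} [Group G] [TopologicalSpace G]
    [TopologicalSpace X] [T2Space X] [LocallyCompactSpace X] [MulAction G X]
    [ContinuousSMul G X] {x y : X} (hx : IsAPpt G x) (hy : y ∈ closure (orbit G x))
    {U : Set X} (hU : U ∈ nhds x) : ∃ t : G, t • y ∈ U := by
  obtain ⟨W, hW, hWU, hWc⟩ := local_compact_nhds hU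
  obtain ⟨K, hK, hKA⟩ := hx W hW
  have horb : orbit G x ⊆ K • W := by
    rintro _ ⟨g, rfl⟩
    obtain ⟨k, hk, a, ha, rfl⟩ := Set.mem_mul.1 (hKA ▸ Set.mem_univ g)
    exact Set.mem_smul.2 ⟨k, hk, a • x, ha, (mul_smul k a x).symm⟩
  obtain ⟨k, -, w, hw, rfl⟩ :=
    Set.mem_smul.1 (closure_minimal horb (hK.smul_set hWc).isClosed hy)
  exact ⟨k⁻¹, by simpa using hWU hw⟩

/-- For an almost periodic point with compact orbit closure, the return times to a neighborhood
are syndetic with respect to a finite set. -/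
theorem IsAPpt.exists_finset {G X : Type u} [Group G] [TopologicalSpace G]
    [TopologicalSpace X] [T2Space X] [LocallyCompactSpace X] [MulAction G X]
    [ContinuousSMul G X] {x : X} (hx : IsAPpt G x) (horb : IsCompact (closure (orbit G x)))
    {U : Set X} (hU : U ∈ nhds x) : ∃ F : Finset G, ∀ g : G, ∃ t ∈ F, (t * g) • x ∈ U := by
  obtain ⟨F, hF⟩ := horb.elim_finite_subcover (fun t : G => (t • ·) ⁻¹' interior U)
    (fun t => isOpen_interior.preimage (continuous_const_smul t))
    (fun y hy => Set.mem_iUnion.2 (hx.exists_smul_mem hy (interior_mem_nhds.2 hU)))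
  refine ⟨F, fun g => ?_⟩
  obtain ⟨t, ht, hmem⟩ := Set.mem_iUnion₂.1 (hF (subset_closure (mem_orbit x g)))
  exact ⟨t, ht, by rw [mul_smul]; exact interior_subset hmem⟩

theorem IsGenSet.mem_pow_gamLen {G : Type u} [Group G] [TopologicalSpace G] {Γ : Set G}
    (hΓ : IsGenSet Γ) (g : G) : g ∈ Γ ^ gamLen Γ g :=
  (Nat.sInf_mem (s := {r : ℕ | 0 < r ∧ g ∈ Γ ^ r}) (hΓ.2.2.2 g)).2

/-- A finite set of group elements lies in a single power of a generating set. -/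
theorem IsGenSet.exists_finset_subset_pow {G : Type u} [Group G] [TopologicalSpace G]
    {Γ : Set G} (hΓ : IsGenSet Γ) (F : Finset G) : ∃ m : ℕ, ∀ t ∈ F, t ∈ Γ ^ m :=
  ⟨F.sup (gamLen Γ), fun t ht =>
    Set.pow_subset_pow_right hΓ.2.1 (Finset.le_sup ht) (hΓ.mem_pow_gamLen t)⟩

/-- A sufficiently long `g` can be shortened within `Γ ^ (|g| - 1 - m) * g` to an element
of `Γ ^ (m + 1)`. -/
theorem IsGenSet.exists_mul_mem_pow {G : Type u} [Group G] [TopologicalSpace G] {Γ : Set G}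
    (hΓ : IsGenSet Γ) {m : ℕ} {g : G} (hg : m + 1 ≤ gamLen Γ g) :
    ∃ h ∈ Γ ^ (gamLen Γ g - 1 - m), h * g ∈ Γ ^ (m + 1) := by
  have hmem := hΓ.mem_pow_gamLen g
  rw [show gamLen Γ g = (gamLen Γ g - 1 - m) + (m + 1) by omega, pow_add] at hmem
  obtain ⟨p, hp, q, hq, hpq⟩ := Set.mem_mul.1 hmem
  refine ⟨p⁻¹, ?_, by rwa [← hpq, inv_mul_cancel_left]⟩
  rwa [← Set.mem_inv, ← inv_pow, hΓ.2.2.1]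

theorem stmt_6 {G X : Type u}
    [Group G] [TopologicalSpace G] [T2Space G] [ContinuousMul G]
    [TopologicalSpace X] [T2Space X] [LocallyCompactSpace X]
    [MulAction G X] [ContinuousSMul G X]
    (horb : ∀ x : X, IsCompact (closure (orbit G x)))
    (Γ : Set G) (hΓ : IsGenSet Γ)
    (x : X) (hx : IsAPpt G x) :
    RecII Γ x := by
  intro U hU ι _ _ _ g hg
  obtain ⟨F, hF⟩ := hx.exists_finset (horb x) hU
  obtain ⟨m, hm⟩ := hΓ.exists_finset_subset_pow F
  obtain ⟨i₀, hi₀⟩ := hg (m + 1)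
  have key : ∀ k : {i // i₀ ≤ i}, ∃ c : G,
      c ∈ KSet Γ (g k) ∧ c • x ∈ U ∧ gamLen Γ c ≤ m + (m + 1) := by
    intro k
    have hlen := hi₀ k k.2
    obtain ⟨h, hh, hhg⟩ := hΓ.exists_mul_mem_pow hlen
    obtain ⟨t, ht, htU⟩ := hF (h * g k)
    refine ⟨t * (h * g k), ?_, htU, Nat.sInf_le ⟨by omega, ?_⟩⟩
    · rw [← mul_assoc]
      refine Set.mul_mem_mul ?_ rfl
      rw [show gamLen Γ (g k) - 1 = m + (gamLen Γ (g k) - 1 - m) by omega, pow_add]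
      exact Set.mul_mem_mul (hm t ht) hh
    · rw [pow_add]
      exact Set.mul_mem_mul (hm t ht) hhg
  choose c hc using key
  refine ⟨m + (m + 1), by omega, {i // i₀ ≤ i}, inferInstance, ⟨⟨i₀, le_rfl⟩⟩, ⟨?_⟩,
    Subtype.val, c, ?_, hc⟩
  · intro a b
    obtain ⟨d, had, hbd⟩ := exists_ge_ge a.1 b.1
    exact ⟨⟨d, a.2.trans had⟩, had, hbd⟩
  · intro i
    obtain ⟨d, hid, hd⟩ := exists_ge_ge i i₀
    exact ⟨⟨d, hd⟩, fun k hk => hid.trans hk⟩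
end

section
/- Let (G,X) be a flow, where G is compactly generated with generating set Γ, and let x ∈ X. If x is Γ-recurrent of type II, then x is Γ-recurrent of type I. -/
/-!
STATEMENT 7. For a flow (G,X) with `G` compactly generated with generating set `Γ`:
every point `Γ`-recurrent of type II is `Γ`-recurrent of type I.
-/

universe u

open Pointwise MulAction

/-- `HLimMem Y y` : there are a subnet of the net of sets `{Y i}` and points of the
corresponding sets converging to `y`. -/
def HLimMem {Z : Type u} [TopologicalSpace Z] {ι : Type u} [Preorder ι]
    (Y : ι → Set Z) (y : Z) : Prop :=
  ∃ (κ : Type u) (pk : Preorder κ),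
    Nonempty κ ∧ IsDirected κ pk.le ∧
    ∃ (φ : κ → ι) (p : κ → Z),
      (∀ i, ∃ k₀, ∀ k, pk.le k₀ k → i ≤ φ k) ∧
      (∀ k, p k ∈ Y (φ k)) ∧
      (∀ U ∈ nhds y, ∃ k₀, ∀ k, pk.le k₀ k → p k ∈ U)

/-- `C` is a `Γ`-cone : there is a net `{g_i}` with `|g_i|` nondecreasing tending to `∞`
such that `K(g_i) ⇀ C`. -/
def IsCone {G : Type u} [Group G] [TopologicalSpace G] (Γ : Set G) (C : Set G) : Prop :=
  ∃ (ι : Type u) (pi : Preorder ι), Nonempty ι ∧ IsDirected ι pi.le ∧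
    ∃ g : ι → G,
      (∀ i j, pi.le i j → gamLen Γ (g i) ≤ gamLen Γ (g j)) ∧
      (∀ n : ℕ, ∃ i₀, ∀ i, pi.le i₀ i → n ≤ gamLen Γ (g i)) ∧
      C = {t | @HLimMem G _ ι pi (fun i => KSet Γ (g i)) t}

/-- `x` is `Γ`-recurrent of type I : `Cx ∩ U ≠ ∅` for every `Γ`-cone `C` and every
neighborhood `U` of `x`. -/
def RecI {G X : Type u} [Group G] [TopologicalSpace G] [TopologicalSpace X] [MulAction G X]
    (Γ : Set G) (x : X) : Prop :=
  ∀ C : Set G, IsCone Γ C → ∀ U ∈ nhds x, ∃ c ∈ C, c • x ∈ U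

/-- Elements of length at most `n` lie in `Γ ^ n`. -/
theorem mem_pow_of_gamLen_le {G : Type u} [Group G] [TopologicalSpace G] {Γ : Set G}
    (hΓ : IsGenSet Γ) {g : G} {n : ℕ} (h : gamLen Γ g ≤ n) : g ∈ Γ ^ n := by
  obtain ⟨r, hr, hg⟩ := hΓ.2.2.2 g
  have hmem : gamLen Γ g ∈ {r : ℕ | 0 < r ∧ g ∈ Γ ^ r} := Nat.sInf_mem ⟨r, hr, hg⟩
  exact Set.pow_subset_pow_right hΓ.2.1 h hmem.2

theorem isCompact_set_pow {G : Type u} [Monoid G] [TopologicalSpace G] [ContinuousMul G]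
    {s : Set G} (hs : IsCompact s) (n : ℕ) : IsCompact (s ^ n) := by
  induction n with
  | zero => simp
  | succ n ih => rw [pow_succ]; exact ih.mul hs

/-- A cluster point of a selection from a subnet of `Y` is a limit of a further subnet. -/
theorem hLimMem_of_mapClusterPt {Z ι κ : Type u} [TopologicalSpace Z] [Preorder ι]
    [Preorder κ] [Nonempty κ] [IsDirected κ (· ≤ ·)] {Y : ι → Set Z} {φ : κ → ι} {p : κ → Z}
    (hφ : ∀ i, ∃ k₀, ∀ k, k₀ ≤ k → i ≤ φ k) (hp : ∀ k, p k ∈ Y (φ k)) {z : Z}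
    (hz : MapClusterPt z Filter.atTop p) : HLimMem Y z := by
  have key : ∀ k₀, ∀ W ∈ nhds z, ∃ k, k₀ ≤ k ∧ p k ∈ W := fun k₀ W hW =>
    Filter.frequently_atTop.1 (mapClusterPt_iff_frequently.1 hz W hW) k₀
  refine ⟨{q : κ × (Set Z)ᵒᵈ // OrderDual.ofDual q.2 ∈ nhds z ∧ p q.1 ∈ OrderDual.ofDual q.2},
    inferInstance, ?_, ⟨?_⟩, fun q => φ q.1.1, fun q => p q.1.1, ?_, fun q => hp _, ?_⟩
  · obtain ⟨k⟩ := ‹Nonempty κ›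
    exact ⟨⟨(k, OrderDual.toDual Set.univ), Filter.univ_mem, Set.mem_univ _⟩⟩
  · rintro ⟨⟨k₁, W₁⟩, h₁, _⟩ ⟨⟨k₂, W₂⟩, h₂, _⟩
    obtain ⟨k₀, hk₁, hk₂⟩ := exists_ge_ge k₁ k₂
    have hW := Filter.inter_mem h₁ h₂
    obtain ⟨k, hk, hkW⟩ := key k₀ _ hW
    exact ⟨⟨(k, OrderDual.toDual (OrderDual.ofDual W₁ ∩ OrderDual.ofDual W₂)), hW, hkW⟩,
      ⟨hk₁.trans hk, Set.inter_subset_left⟩, ⟨hk₂.trans hk, Set.inter_subset_right⟩⟩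
  · intro i
    obtain ⟨k₀, hk₀⟩ := hφ i
    exact ⟨⟨(k₀, OrderDual.toDual Set.univ), Filter.univ_mem, Set.mem_univ _⟩,
      fun q hq => hk₀ _ hq.1⟩
  · intro U hU
    obtain ⟨k₀⟩ := ‹Nonempty κ›
    obtain ⟨k, -, hk⟩ := key k₀ U hU
    exact ⟨⟨(k, OrderDual.toDual U), hU, hk⟩, fun q hq => hq.2 q.2.2⟩

theorem stmt_7 {G X : Type u}
    [Group G] [TopologicalSpace G] [T2Space G] [ContinuousMul G]
    [TopologicalSpace X] [T2Space X] [LocallyCompactSpace X]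
    [MulAction G X] [ContinuousSMul G X]
    (horb : ∀ x : X, IsCompact (closure (orbit G x)))
    (Γ : Set G) (hΓ : IsGenSet Γ)
    (x : X) (hx : RecII Γ x) :
    RecI Γ x := by
  rintro C ⟨ι, _, _, _, g, _, hg, rfl⟩ U hU
  obtain ⟨V, hV, hVc, hVU⟩ := exists_mem_nhds_isClosed_subset hU
  obtain ⟨n, -, κ, _, _, _, φ, c, hφ, hc⟩ := hx V hV ι g hg
  obtain ⟨t, -, ht⟩ := (isCompact_set_pow hΓ.1 n).exists_mapClusterPt (f := Filter.atTop)
    (Filter.tendsto_principal.2 (.of_forall fun k => mem_pow_of_gamLen_le hΓ (hc k).2.2))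
  refine ⟨t, hLimMem_of_mapClusterPt (Y := fun i => KSet Γ (g i)) hφ (fun k => (hc k).1) ht,
    hVU ?_⟩
  have hclosed : IsClosed {s : G | s • x ∈ V} :=
    hVc.preimage (continuous_id.smul continuous_const)
  exact hclosed.mem_of_mapClusterPt ht (Filter.Eventually.of_forall fun k => (hc k).2.1)
end

section
/- Let (G,X) be a flow with G finitely generated and X a compact metric space. Then (G,X) is regularly almost periodic if and only if (G,X) is pointwise regularly almost periodic and weakly almost periodic. -/
/-!
STATEMENT 15. Let (G,X) be a flow with `G` a finitely generated (discrete) group and `X`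
a compact metric space.  Then (G,X) is regularly almost periodic iff (G,X) is pointwise
regularly almost periodic and weakly almost periodic.
-/

universe u

open Pointwise

/-- `A` is syndetic in the discrete group `G` : `G = FA` for some finite `F ⊆ G`. -/
def DSyndetic {G : Type u} [Group G] (A : Set G) : Prop :=
  ∃ F : Set G, F.Finite ∧ F * A = Set.univ

/-- `x` is a regularly almost periodic point. -/
def IsRegAPpt (G : Type u) {X : Type u} [Group G] [TopologicalSpace X]
    [MulAction G X] (x : X) : Prop :=
  ∀ U ∈ nhds x, ∃ H : Subgroup G, DSyndetic (H : Set G) ∧ ∀ h ∈ H, h • x ∈ U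

/-- (G,X) is regularly almost periodic. -/
def RegAPFlow (G X : Type u) [Group G] [UniformSpace X] [MulAction G X] : Prop :=
  ∀ α ∈ uniformity X, ∃ H : Subgroup G, DSyndetic (H : Set G) ∧
    ∀ x : X, ∀ h ∈ H, (x, h • x) ∈ α

/-- (G,X) is weakly almost periodic : for every entourage `α` there is a finite `F ⊆ G`
such that `Ftx ∩ α[x] ≠ ∅` for all `x ∈ X` and `t ∈ G`. -/
def WeaklyAPFlow (G X : Type u) [Group G] [UniformSpace X] [MulAction G X] : Prop :=
  ∀ α ∈ uniformity X, ∃ F : Set G, F.Finite ∧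
    ∀ x : X, ∀ t : G, ∃ f ∈ F, (x, (f * t) • x) ∈ α

open Filter Topology MulAction Metric

theorem DSyndetic.finiteIndex {G : Type u} [Group G] {H : Subgroup G}
    (h : DSyndetic (H : Set G)) : H.FiniteIndex := by
  obtain ⟨F, hF, hFH⟩ := h
  have : Finite F := hF
  have hsurj : Function.Surjective (fun f : F => (QuotientGroup.mk (f : G) : G ⧸ H)) := by
    intro q
    obtain ⟨g, rfl⟩ := QuotientGroup.mk_surjective q
    obtain ⟨f, hf, k, hk, rfl⟩ := Set.mem_mul.1 (hFH ▸ Set.mem_univ g : g ∈ F * (H : Set G))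
    refine ⟨⟨f, hf⟩, QuotientGroup.eq.2 ?_⟩
    simpa using hk
  have := Finite.of_surjective _ hsurj
  exact H.finiteIndex_of_finite_quotient

theorem Subgroup.dSyndetic {G : Type u} [Group G] (H : Subgroup G) [H.FiniteIndex] :
    DSyndetic (H : Set G) := by
  refine ⟨Set.range (fun q : G ⧸ H => q.out), Set.finite_range _, ?_⟩
  refine Set.eq_univ_of_forall fun g => Set.mem_mul.2
    ⟨(g : G ⧸ H).out, ⟨_, rfl⟩, ((g : G ⧸ H).out)⁻¹ * g, ?_, by simp⟩
  exact QuotientGroup.eq.1 (QuotientGroup.out_eq' (g : G ⧸ H))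

theorem RegAPFlow.isRegAPpt {G X : Type u} [Group G] [UniformSpace X] [MulAction G X]
    (h : RegAPFlow G X) (x : X) : IsRegAPpt G x := by
  intro U hU
  obtain ⟨α, hα, hαU⟩ := UniformSpace.mem_nhds_iff.1 hU
  obtain ⟨H, hH, hx⟩ := h α hα
  exact ⟨H, hH, fun k hk => hαU (hx x k hk)⟩

theorem RegAPFlow.weaklyAPFlow {G X : Type u} [Group G] [UniformSpace X] [MulAction G X]
    (h : RegAPFlow G X) : WeaklyAPFlow G X := by
  intro α hα
  obtain ⟨H, ⟨F, hF, hFH⟩, hx⟩ := h α hα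
  refine ⟨F⁻¹, hF.inv, fun x t => ?_⟩
  obtain ⟨f, hf, k, hk, rfl⟩ := Set.mem_mul.1 (hFH ▸ Set.mem_univ t : t ∈ F * (H : Set G))
  exact ⟨f⁻¹, Set.inv_mem_inv.2 hf, by simpa using hx x k hk⟩

section Orbits

variable {G X : Type u} [Group G] [MulAction G X]

instance Subgroup.continuousConstSMul [TopologicalSpace X] [ContinuousConstSMul G X]
    (H : Subgroup G) : ContinuousConstSMul H X :=
  ⟨fun k => continuous_const_smul (k : G)⟩

theorem closure_orbit_subset_of_mem [TopologicalSpace X] [ContinuousConstSMul G X]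
    {H : Subgroup G} {x y : X} (h : y ∈ closure (orbit H x)) :
    closure (orbit H y) ⊆ closure (orbit H x) := by
  refine closure_minimal ?_ isClosed_closure
  rintro _ ⟨k, rfl⟩
  have := Set.smul_mem_smul_set (a := k) h
  rwa [← closure_smul, smul_orbit] at this

/-- The translates of a set by representatives of the cosets of a finite-index subgroup `L`
cover the orbit of `x` as soon as the set contains the `L`-orbit of `x`. -/
theorem orbit_subset_iUnion_out_smul {L : Subgroup G} {x : X} {U : Set X}
    (hU : ∀ l ∈ L, l • x ∈ U) : orbit G x ⊆ ⋃ q : G ⧸ L, q.out • U := by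
  rintro _ ⟨g, rfl⟩
  refine Set.mem_iUnion.2 ⟨(g : G ⧸ L), Set.mem_smul_set_iff_inv_smul_mem.2 ?_⟩
  have := hU _ (QuotientGroup.eq.1 (QuotientGroup.out_eq' (g : G ⧸ L)))
  simpa [mul_smul] using this

theorem IsRegAPpt.mem_closure_orbit [TopologicalSpace X] [RegularSpace X]
    [ContinuousConstSMul G X] {x : X} (hx : IsRegAPpt G x) {H : Subgroup G} {y : X}
    (h : y ∈ closure (orbit H x)) : x ∈ closure (orbit H y) := by
  refine mem_closure_iff_nhds_basis (closed_nhds_basis x) |>.2 ?_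
  rintro U ⟨hU, hUc⟩
  obtain ⟨L, hL, hLU⟩ := hx U hU
  have := hL.finiteIndex
  have hcover : orbit H x ⊆ ⋃ q : H ⧸ L.subgroupOf H, q.out • U :=
    orbit_subset_iUnion_out_smul fun l hl => hLU l (Subgroup.mem_subgroupOf.1 hl)
  have hclosed : IsClosed (⋃ q : H ⧸ L.subgroupOf H, q.out • U) :=
    isClosed_iUnion_of_finite fun q => hUc.smul q.out
  obtain ⟨q, hq⟩ := Set.mem_iUnion.1 (closure_minimal hcover hclosed h)
  exact ⟨q.out⁻¹ • y, ⟨q.out⁻¹, rfl⟩, Set.mem_smul_set_iff_inv_smul_mem.1 hq⟩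

theorem closure_orbit_eq_of_mem [TopologicalSpace X] [RegularSpace X]
    [ContinuousConstSMul G X] {x : X} (hx : IsRegAPpt G x) {H : Subgroup G} {y : X}
    (h : y ∈ closure (orbit H x)) : closure (orbit H y) = closure (orbit H x) :=
  (closure_orbit_subset_of_mem h).antisymm (closure_orbit_subset_of_mem (hx.mem_closure_orbit h))

theorem orbit_top_subgroup (x : X) : orbit (⊤ : Subgroup G) x = orbit G x := by
  ext y
  simp [mem_orbit_iff]

theorem closure_orbit_smul [TopologicalSpace X] [ContinuousConstSMul G X]
    (H : Subgroup G) [H.Normal] (g : G) (x : X) :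
    closure (orbit H (g • x)) = g • closure (orbit H x) := by
  rw [← closure_smul, smul_orbit_eq_orbit_smul]

theorem finite_range_closure_orbit_smul [TopologicalSpace X] [ContinuousConstSMul G X]
    (H : Subgroup G) [H.Normal] [H.FiniteIndex] (x : X) :
    (Set.range fun g : G => closure (orbit H (g • x))).Finite := by
  refine (Set.finite_range fun q : G ⧸ H => closure (orbit H (q.out • x))).subset ?_
  rintro _ ⟨g, rfl⟩
  refine ⟨(g : G ⧸ H), ?_⟩
  have hk := QuotientGroup.eq.1 (QuotientGroup.out_eq' (g : G ⧸ H))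
  have : orbit H ((((g : G ⧸ H).out)⁻¹ * g) • x) = orbit H x := orbit_smul (⟨_, hk⟩ : H) x
  have h2 := closure_orbit_smul H (g : G ⧸ H).out ((((g : G ⧸ H).out)⁻¹ * g) • x)
  rw [this, ← closure_orbit_smul, smul_smul, mul_inv_cancel_left] at h2
  exact h2.symm

theorem exists_mem_closure_orbit_smul [TopologicalSpace X] [ContinuousConstSMul G X]
    (H : Subgroup G) [H.Normal] [H.FiniteIndex] {x z : X} (hz : z ∈ closure (orbit G x)) :
    ∃ g : G, z ∈ closure (orbit H (g • x)) := by
  have hcover : orbit G x ⊆ ⋃ q : G ⧸ H, q.out • closure (orbit H x) :=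
    orbit_subset_iUnion_out_smul fun l hl => subset_closure ⟨⟨l, hl⟩, rfl⟩
  have hclosed : IsClosed (⋃ q : G ⧸ H, q.out • closure (orbit H x)) :=
    isClosed_iUnion_of_finite fun q => isClosed_closure.smul q.out
  obtain ⟨q, hq⟩ := Set.mem_iUnion.1 (closure_minimal hcover hclosed hz)
  exact ⟨q.out, by rwa [closure_orbit_smul]⟩

end Orbits

/-- Upper semicontinuity of orbit closures. -/
theorem WeaklyAPFlow.eventually_orbit_subset {G X : Type u} [Group G] [MetricSpace X]
    [CompactSpace X] [MulAction G X] [ContinuousConstSMul G X] (hw : WeaklyAPFlow G X)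
    (hp : ∀ x : X, IsRegAPpt G x) (x : X) {N : Set X} (hN : IsOpen N)
    (hxN : closure (orbit G x) ⊆ N) : ∀ᶠ y in 𝓝 x, ∀ t : G, t • y ∈ N := by
  by_contra hcon
  obtain ⟨y, hy, hyN⟩ := exists_seq_forall_of_frequently (not_eventually.1 hcon)
  push Not at hyN
  choose t ht using hyN
  obtain ⟨z, hz, φ, hφ, hlim⟩ := hN.isClosed_compl.isCompact.tendsto_subseq ht
  have hyφ := hy.comp hφ.tendsto_atTop
  have hxz : x ∈ closure (orbit G z) := by
    refine Metric.mem_closure_iff.2 fun ε hε => ?_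
    by_contra! hfar
    obtain ⟨F, hF, hFα⟩ := hw _ (Metric.dist_mem_uniformity (half_pos hε))
    have hev : ∀ᶠ n in atTop, ∀ f ∈ F,
        ε / 2 < dist (y (φ n)) (f • t (φ n) • y (φ n)) := by
      refine (eventually_all_finite hF).2 fun f _ => ?_
      have : Tendsto (fun n => dist (y (φ n)) (f • t (φ n) • y (φ n))) atTop
          (𝓝 (dist x (f • z))) := hyφ.dist (hlim.const_smul f)
      exact this.eventually (lt_mem_nhds ((half_lt_self hε).trans_le (hfar _ ⟨f, rfl⟩)))
    obtain ⟨n, hn⟩ := hev.exists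
    obtain ⟨f, hf, hfd⟩ := hFα (y (φ n)) (t (φ n))
    rw [mul_smul] at hfd
    exact lt_asymm (hn f hf) hfd
  refine hz (hxN ?_)
  rw [← orbit_top_subgroup] at hxz ⊢
  exact (hp z).mem_closure_orbit hxz

/-- Near each point, the orbits of a suitable finite-index subgroup are small: near the closure of
`orbit G x`, points follow its decomposition into orbit closures of the subgroup, because each of
the finitely many generators respects a neighbourhood of it. -/
theorem WeaklyAPFlow.exists_subgroup_eventually_dist_lt {G X : Type u} [Group G] [Group.FG G]
    [MetricSpace X] [CompactSpace X] [MulAction G X] [ContinuousConstSMul G X]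
    (hw : WeaklyAPFlow G X) (hp : ∀ x : X, IsRegAPpt G x) (x : X) {ε : ℝ} (hε : 0 < ε) :
    ∃ H : Subgroup G, H.FiniteIndex ∧ ∀ᶠ y in 𝓝 x, ∀ h ∈ H, dist y (h • y) < ε := by
  obtain ⟨L, hL, hLU⟩ := hp x _ (closedBall_mem_nhds x (by positivity : 0 < ε / 4))
  have := hL.finiteIndex
  set H := L.normalCore
  have hball : closure (orbit H x) ⊆ closedBall x (ε / 4) := by
    refine closure_minimal ?_ isClosed_closedBall
    rintro _ ⟨k, rfl⟩
    exact hLU _ (L.normalCore_le k.2)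
  have hfin := finite_range_closure_orbit_smul H x
  have hsep : ∀ᶠ δ in 𝓝[>] (0 : ℝ), ∀ A ∈ Set.range fun g : G => closure (orbit H (g • x)),
      ∀ B ∈ Set.range fun g : G => closure (orbit H (g • x)),
        A ≠ B → Disjoint (thickening δ A) (thickening δ B) := by
    refine (eventually_all_finite hfin).2 fun A hA => (eventually_all_finite hfin).2 fun B hB => ?_
    by_cases hAB : A = B
    · simp [hAB]
    obtain ⟨a, rfl⟩ := hA
    obtain ⟨b, rfl⟩ := hB
    have hd : Disjoint (closure (orbit H (a • x))) (closure (orbit H (b • x))) :=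
      Set.disjoint_left.2 fun z hza hzb => hAB <|
        (closure_orbit_eq_of_mem (hp _) hza).symm.trans (closure_orbit_eq_of_mem (hp _) hzb)
    obtain ⟨δ, hδ, hdδ⟩ := hd.exists_thickenings isClosed_closure.isCompact isClosed_closure
    filter_upwards [Ioo_mem_nhdsGT hδ] with η hη _
    exact hdδ.mono (thickening_mono hη.2.le _) (thickening_mono hη.2.le _)
  obtain ⟨δ, hδsep, hδ⟩ := (hsep.and self_mem_nhdsWithin).exists
  obtain ⟨S, hS, hSfin⟩ := (Monoid.fg_iff (M := G)).1 (Group.fg_iff_monoid_fg.1 inferInstance)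
  have hunif : ∀ᶠ η in 𝓝[>] (0 : ℝ), ∀ s ∈ S, ∀ a b : X, dist a b < η →
      dist (s • a) (s • b) < δ := by
    refine (eventually_all_finite hSfin).2 fun s _ => ?_
    obtain ⟨η, hη, hs⟩ := Metric.uniformContinuous_iff.1
      (CompactSpace.uniformContinuous_of_continuous (continuous_const_smul (T := X) s)) δ hδ
    filter_upwards [Ioo_mem_nhdsGT hη] with θ hθ a b hab
    exact hs (hab.trans hθ.2)
  obtain ⟨η, hηS, ⟨hη, hηδ⟩, -, hηε⟩ := (hunif.and (Filter.inter_mem (Ioo_mem_nhdsGT hδ)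
    (Ioo_mem_nhdsGT (by positivity : 0 < ε / 4)))).exists
  refine ⟨H, inferInstance, ?_⟩
  filter_upwards [hw.eventually_orbit_subset hp x isOpen_thickening
    (self_subset_thickening hη (closure (orbit G x))), ball_mem_nhds x hη,
    ball_mem_nhds x (by positivity : 0 < ε / 4)] with y hyN hyη hyε
  have key : ∀ g : G, g • y ∈ thickening η (closure (orbit H (g • x))) := by
    intro g
    induction (hS ▸ Submonoid.mem_top g : g ∈ Submonoid.closure S)
      using Submonoid.closure_induction_left with
    | one =>
      rw [one_smul, one_smul]
      exact mem_thickening_iff.2 ⟨x, subset_closure (mem_orbit_self x), hyη⟩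
    | mul_left s hs g _ ih =>
      obtain ⟨a, ha, hya⟩ := mem_thickening_iff.1 ih
      obtain ⟨b, hb, hyb⟩ := mem_thickening_iff.1 (hyN (s * g))
      obtain ⟨g', hg'⟩ := exists_mem_closure_orbit_smul H hb
      have hsa : s • a ∈ closure (orbit H ((s * g) • x)) := by
        rw [mul_smul, closure_orbit_smul]
        exact Set.smul_mem_smul_set ha
      have h1 : (s * g) • y ∈ thickening δ (closure (orbit H ((s * g) • x))) :=
        mem_thickening_iff.2 ⟨_, hsa, by rw [mul_smul]; exact hηS s hs _ _ hya⟩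
      have h2 : (s * g) • y ∈ thickening η (closure (orbit H (g' • x))) :=
        mem_thickening_iff.2 ⟨b, hg', hyb⟩
      have heq : closure (orbit H ((s * g) • x)) = closure (orbit H (g' • x)) := by
        by_contra hne
        exact Set.disjoint_left.1 (hδsep _ ⟨_, rfl⟩ _ ⟨_, rfl⟩ hne) h1
          (thickening_mono hηδ.le _ h2)
      rwa [heq]
  intro h hh
  have horb : orbit H (h • x) = orbit H x := orbit_smul (⟨h, hh⟩ : H) x
  obtain ⟨a, ha, hya⟩ := mem_thickening_iff.1 (horb ▸ key h)
  have h1 : dist a x ≤ ε / 4 := hball ha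
  have h2 : dist y x < ε / 4 := hyε
  rw [dist_comm] at hya
  have h4 := dist_triangle4 y x a (h • y)
  rw [dist_comm x a] at h4
  linarith

theorem stmt_15 {G X : Type u}
    [Group G] [Group.FG G]
    [MetricSpace X] [CompactSpace X]
    [MulAction G X] (hc : ∀ g : G, Continuous fun y : X => g • y) :
    RegAPFlow G X ↔ ((∀ x : X, IsRegAPpt G x) ∧ WeaklyAPFlow G X) := by
  have : ContinuousConstSMul G X := ⟨hc⟩
  refine ⟨fun h => ⟨h.isRegAPpt, h.weaklyAPFlow⟩, fun ⟨hp, hw⟩ α hα => ?_⟩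
  obtain ⟨ε, hε, hεα⟩ := Metric.mem_uniformity_dist.1 hα
  choose H hH hV using fun x : X => hw.exists_subgroup_eventually_dist_lt hp x hε
  obtain ⟨t, ht⟩ := CompactSpace.elim_nhds_subcover _ hV
  have hfi : (⨅ x ∈ t, H x).FiniteIndex := Subgroup.finiteIndex_iInf' _ fun x _ => hH x
  refine ⟨⨅ x ∈ t, H x, Subgroup.dSyndetic _, fun y h hh => hεα ?_⟩
  obtain ⟨x, hxt, hyx⟩ := Set.mem_iUnion₂.1 (ht.ge (Set.mem_univ y))
  exact hyx h (Subgroup.mem_iInf.1 (Subgroup.mem_iInf.1 hh x) hxt)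
end

section
/- Let X be a zero-dimensional locally compact Hausdorff space and let G be an equicontinuously generated group of homeomorphisms of X. Let V be an open subset of X and V_∞ = ⋂_{g∈G} gV. Suppose V_∞ is compact. Then V_∞ is open if and only if cl(Gx) ∩ V_∞ = ∅ for every x ∈ X \ V_∞. -/
/-!
STATEMENT 18. Let `X` be a zero-dimensional locally compact Hausdorff space and `G = ⟨S⟩`
an equicontinuously generated group of homeomorphisms of `X`.  Let `V ⊆ X` be open and
`V_∞ = ⋂_{g∈G} gV`.  If `V_∞` is compact, then `V_∞` is open iff
`cl(Gx) ∩ V_∞ = ∅` for every `x ∈ X \ V_∞`.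
-/

universe u

open scoped UniformConvergence Pointwise

variable (X : Type u) [UniformSpace X]

/-- The group of self-homeomorphisms of `X` under composition (`f * g = f ∘ g`). -/
instance : Group (X ≃ₜ X) where
  one := Homeomorph.refl X
  mul f g := g.trans f
  inv := Homeomorph.symm
  mul_assoc f g h := by ext x; rfl
  one_mul f := by ext x; rfl
  mul_one f := by ext x; rfl
  inv_mul_cancel f := by ext x; exact f.symm_apply_apply x

/-- The tautological action of `Homeo(X)` on `X`. -/
instance : MulAction (X ≃ₜ X) X where
  smul h x := h x
  one_smul _ := rfl
  mul_smul _ _ _ := rfl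

variable {X}

/-- `⟨T⟩ = ⋃_{r ≥ 1} T^r`, the group generated by a symmetric set `T` of homeomorphisms
containing the identity. -/
def GSet (T : Set (X ≃ₜ X)) : Set (X ≃ₜ X) :=
  {g | ∃ r : ℕ, 1 ≤ r ∧ g ∈ T ^ r}

/-- The orbit `⟨T⟩x`. -/
def orbT (T : Set (X ≃ₜ X)) (x : X) : Set X :=
  {y : X | ∃ g ∈ GSet T, y = g • x}

/-- The points all of whose images under `S` lie in `A`. -/
def allImagesIn (S : Set (X ≃ₜ X)) (A : Set X) : Set X :=
  {x | ∀ s ∈ S, s • x ∈ A}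

/-- The points of `U` with some image under `S` in `A`. -/
def someImageIn (S : Set (X ≃ₜ X)) (U A : Set X) : Set X :=
  {x | x ∈ U ∧ ∃ s ∈ S, s • x ∈ A}

theorem GSet_eq_closure {S : Set (X ≃ₜ X)} (hid : 1 ∈ S) (hsymm : ∀ h ∈ S, h⁻¹ ∈ S) :
    GSet S = (Subgroup.closure S : Set (X ≃ₜ X)) := by
  have pow_subset : ∀ r : ℕ, ∀ g ∈ S ^ r, g ∈ Subgroup.closure S := by
    intro r
    induction r with
    | zero =>
      intro g hg
      rw [pow_zero, Set.mem_one] at hg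
      exact hg ▸ one_mem _
    | succ r ih =>
      intro g hg
      rw [pow_succ] at hg
      obtain ⟨a, ha, b, hb, rfl⟩ := Set.mem_mul.1 hg
      exact mul_mem (ih a ha) (Subgroup.subset_closure hb)
  have inv_mem_pow : ∀ r : ℕ, ∀ g ∈ S ^ r, g⁻¹ ∈ S ^ r := by
    intro r
    induction r with
    | zero =>
      intro g hg
      rw [pow_zero, Set.mem_one] at hg ⊢
      rw [hg, inv_one]
    | succ r ih =>
      intro g hg
      rw [pow_succ] at hg
      obtain ⟨a, ha, b, hb, rfl⟩ := Set.mem_mul.1 hg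
      rw [pow_succ', mul_inv_rev]
      exact Set.mul_mem_mul (hsymm b hb) (ih a ha)
  ext g
  constructor
  · rintro ⟨r, -, hg⟩
    exact pow_subset r g hg
  · intro hg
    induction hg using Subgroup.closure_induction with
    | mem x hx => exact ⟨1, le_rfl, by rwa [pow_one]⟩
    | one => exact ⟨1, le_rfl, by rwa [pow_one]⟩
    | mul a b _ _ ha hb =>
      obtain ⟨r, hr, har⟩ := ha
      obtain ⟨t, ht, hbt⟩ := hb
      exact ⟨r + t, by omega, by rw [pow_add]; exact Set.mul_mem_mul har hbt⟩
    | inv a _ ha =>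
      obtain ⟨r, hr, har⟩ := ha
      exact ⟨r, hr, inv_mem_pow r a har⟩

theorem mem_iInter_smul_subgroup (H : Subgroup (X ≃ₜ X)) (V : Set X) (x : X) :
    x ∈ (⋂ g ∈ (H : Set (X ≃ₜ X)), g • V) ↔ ∀ g ∈ H, g • x ∈ V := by
  simp only [Set.mem_iInter, SetLike.mem_coe, Set.mem_smul_set_iff_inv_smul_mem]
  exact ⟨fun h g hg => by simpa using h g⁻¹ (inv_mem hg), fun h g hg => h g⁻¹ (inv_mem hg)⟩

theorem exists_isClopen_isCompact_between [T2Space X] [LocallyCompactSpace X]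
    (hzero : TopologicalSpace.IsTopologicalBasis {s : Set X | IsClopen s})
    {K V : Set X} (hK : IsCompact K) (hV : IsOpen V) (hKV : K ⊆ V) :
    ∃ U : Set X, IsClopen U ∧ IsCompact U ∧ K ⊆ U ∧ U ⊆ V := by
  obtain ⟨L, hL, hKL, hLV⟩ := exists_compact_between hK hV hKV
  have : ∃ U : Set X, IsClopen U ∧ K ⊆ U ∧ U ⊆ L := by
    refine hK.induction_on (p := fun s => ∃ U : Set X, IsClopen U ∧ s ⊆ U ∧ U ⊆ L)
      ⟨∅, isClopen_empty, subset_rfl, Set.empty_subset _⟩ ?_ ?_ ?_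
    · rintro s t hst ⟨U, hU, htU, hUL⟩
      exact ⟨U, hU, hst.trans htU, hUL⟩
    · rintro s t ⟨U, hU, hsU, hUL⟩ ⟨W, hW, htW, hWL⟩
      exact ⟨U ∪ W, hU.union hW, Set.union_subset_union hsU htW, Set.union_subset hUL hWL⟩
    · intro x hx
      obtain ⟨U, hU, hxU, hUL⟩ := hzero.exists_subset_of_mem_open (hKL hx) isOpen_interior
      exact ⟨U, mem_nhdsWithin_of_mem_nhds (hU.isOpen.mem_nhds hxU), U, hU, subset_rfl,
        hUL.trans interior_subset⟩
  obtain ⟨U, hU, hKU, hUL⟩ := this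
  exact ⟨U, hU, hL.of_isClosed_subset hU.isClosed hUL, hKU, hUL.trans hLV⟩

/-- An equicontinuous family cannot separate nearby points by a compact open set. -/
theorem eventually_smul_mem_iff {S : Set (X ≃ₜ X)}
    (hequi : Equicontinuous (fun h : S => (h.1 : X → X)))
    {A : Set X} (hA : IsClopen A) (hAc : IsCompact A) (x : X) :
    ∀ᶠ y in nhds x, ∀ s ∈ S, (s • x ∈ A ↔ s • y ∈ A) := by
  obtain ⟨E, hE, hd⟩ := (disjoint_compl_right (a := A)).exists_uniform_thickening hAc
    hA.compl.isClosed
  rw [Set.disjoint_left] at hd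
  have sep : ∀ a ∈ A, ∀ b ∉ A, ∀ c, (a, c) ∈ E → (b, c) ∉ E := fun a ha b hb c hac hbc =>
    hd (Set.mem_iUnion₂.2 ⟨a, ha, hac⟩) (Set.mem_iUnion₂.2 ⟨b, hb, hbc⟩)
  filter_upwards [hequi x _ (Filter.inter_mem hE (symm_le_uniformity hE))] with y hy s hs
  have h := hy ⟨s, hs⟩
  refine ⟨fun hx => ?_, fun hy' => ?_⟩
  · by_contra hn
    exact sep _ hx _ hn _ h.1 (refl_mem_uniformity hE)
  · by_contra hn
    exact sep _ hy' _ hn _ h.2 (refl_mem_uniformity hE)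

theorem isClopen_of_eventually_mem_iff {A : Set X}
    (h : ∀ x, ∀ᶠ y in nhds x, (x ∈ A ↔ y ∈ A)) : IsClopen A := by
  refine ⟨⟨isOpen_iff_mem_nhds.2 fun x hx => ?_⟩, isOpen_iff_mem_nhds.2 fun x hx => ?_⟩
  · filter_upwards [h x] with y hy
    exact fun hyA => hx (hy.2 hyA)
  · filter_upwards [h x] with y hy
    exact hy.1 hx

theorem isClopen_allImagesIn {S : Set (X ≃ₜ X)}
    (hequi : Equicontinuous (fun h : S => (h.1 : X → X)))
    {A : Set X} (hA : IsClopen A) (hAc : IsCompact A) : IsClopen (allImagesIn S A) := by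
  refine isClopen_of_eventually_mem_iff fun x => ?_
  filter_upwards [eventually_smul_mem_iff hequi hA hAc x] with y hy
  exact forall₂_congr hy

theorem isClopen_someImageIn {S : Set (X ≃ₜ X)}
    (hequi : Equicontinuous (fun h : S => (h.1 : X → X)))
    {U A : Set X} (hU : IsClopen U) (hA : IsClopen A) (hAc : IsCompact A) :
    IsClopen (someImageIn S U A) := by
  refine hU.inter (isClopen_of_eventually_mem_iff (A := {x | ∃ s ∈ S, s • x ∈ A}) fun x => ?_)
  filter_upwards [eventually_smul_mem_iff hequi hA hAc x] with y hy
  exact exists_congr fun s => and_congr_right (hy s)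

theorem allImagesIn_mono (S : Set (X ≃ₜ X)) : Monotone (allImagesIn S) :=
  fun _ _ h _ hx s hs => h (hx s hs)

theorem someImageIn_mono (S : Set (X ≃ₜ X)) (U : Set X) : Monotone (someImageIn S U) :=
  fun _ _ h _ hx => ⟨hx.1, hx.2.imp fun _ hs => ⟨hs.1, h hs.2⟩⟩

theorem allImagesIn_subset {S : Set (X ≃ₜ X)} (hid : 1 ∈ S) (A : Set X) :
    allImagesIn S A ⊆ A :=
  fun x hx => by simpa using hx 1 hid

theorem someImageIn_allImagesIn_subset {S : Set (X ≃ₜ X)} (hsymm : ∀ h ∈ S, h⁻¹ ∈ S)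
    (U A : Set X) : someImageIn S U (allImagesIn S A) ⊆ A := by
  rintro x ⟨-, s, hs, hx⟩
  simpa using hx s⁻¹ (hsymm s hs)

theorem antitone_iterate_allImagesIn {S : Set (X ≃ₜ X)} (hid : 1 ∈ S) (U : Set X) :
    Antitone fun n => (allImagesIn S)^[n] U :=
  antitone_nat_of_succ_le fun n => by
    rw [Function.iterate_succ_apply']
    exact allImagesIn_subset hid _

theorem antitone_iterate_someImageIn {S : Set (X ≃ₜ X)} (hsymm : ∀ h ∈ S, h⁻¹ ∈ S)
    (U : Set X) : Antitone fun n => (someImageIn S U)^[n] ((allImagesIn S)^[n] U) :=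
  antitone_nat_of_succ_le fun n => by
    rw [Function.iterate_succ_apply, Function.iterate_succ_apply']
    exact (someImageIn_mono S U).iterate n (someImageIn_allImagesIn_subset hsymm U _)

theorem subset_iterate_allImagesIn {S : Set (X ≃ₜ X)} (hid : 1 ∈ S)
    (hsymm : ∀ h ∈ S, h⁻¹ ∈ S) {U B : Set X} (n : ℕ) {A : Set X}
    (hA : A ⊆ (allImagesIn S)^[n] U) (hB : (someImageIn S U)^[n] A ⊆ B) :
    A ⊆ (allImagesIn S)^[n] B := by
  induction n generalizing A with
  | zero => exact hB
  | succ n ih =>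
    have hAU : A ⊆ allImagesIn S U :=
      hA.trans (antitone_iterate_allImagesIn hid U (Nat.le_add_left 1 n))
    rw [Function.iterate_succ_apply'] at hA ⊢
    have h := ih ((someImageIn_mono S U hA).trans (someImageIn_allImagesIn_subset hsymm U _)) hB
    exact fun x hx s hs => h ⟨hAU hx s hs, s⁻¹, hsymm s hs, by simpa using hx⟩

theorem exists_smul_mem_of_mem_iterate_someImageIn {S : Set (X ≃ₜ X)} {U A : Set X} (n : ℕ)
    {x : X} (hx : x ∈ (someImageIn S U)^[n] A) : ∃ g ∈ Subgroup.closure S, g • x ∈ A := by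
  induction n generalizing x with
  | zero => exact ⟨1, one_mem _, by simpa using hx⟩
  | succ n ih =>
    rw [Function.iterate_succ_apply'] at hx
    obtain ⟨-, s, hs, hsx⟩ := hx
    obtain ⟨g, hg, hgx⟩ := ih hsx
    exact ⟨g * s, mul_mem hg (Subgroup.subset_closure hs), by rwa [mul_smul]⟩

theorem mem_iterate_allImagesIn {S : Set (X ≃ₜ X)} {U : Set X} {x : X}
    (hx : ∀ g ∈ Subgroup.closure S, g • x ∈ U) (n : ℕ) : x ∈ (allImagesIn S)^[n] U := by
  induction n generalizing x with
  | zero => simpa using hx 1 (one_mem _)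
  | succ n ih =>
    rw [Function.iterate_succ_apply']
    exact fun s hs => ih fun g hg => by
      simpa [mul_smul] using hx (g * s) (mul_mem hg (Subgroup.subset_closure hs))

theorem smul_mem_of_forall_mem_iterate_allImagesIn {S : Set (X ≃ₜ X)}
    (hsymm : ∀ h ∈ S, h⁻¹ ∈ S) {U : Set X} {x : X}
    (hx : ∀ n, x ∈ (allImagesIn S)^[n] U) {g : X ≃ₜ X} (hg : g ∈ Subgroup.closure S) :
    g • x ∈ U := by
  have step : ∀ s ∈ S, ∀ y : X, (∀ n, y ∈ (allImagesIn S)^[n] U) →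
      ∀ n, s • y ∈ (allImagesIn S)^[n] U := fun s hs y hy n => by
    have h := hy (n + 1)
    rw [Function.iterate_succ_apply'] at h
    exact h s hs
  suffices ∀ n, g • x ∈ (allImagesIn S)^[n] U from this 0
  induction hg using Subgroup.closure_induction'' generalizing x with
  | mem s hs => exact step s hs x hx
  | inv_mem s hs => exact step s⁻¹ (hsymm s hs) x hx
  | one => simpa using hx
  | mul a b _ _ ha hb =>
    rw [mul_smul]
    exact ha (hb hx)

theorem stmt_18 {X : Type u} [UniformSpace X] [T2Space X] [LocallyCompactSpace X]
    (hzero : TopologicalSpace.IsTopologicalBasis {s : Set X | IsClopen s})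
    (S : Set (X ≃ₜ X))
    (hid : (1 : X ≃ₜ X) ∈ S)
    (hsymm : ∀ h ∈ S, h⁻¹ ∈ S)
    (hequi : Equicontinuous (fun h : S => (h.1 : X → X)))
    (V : Set X) (hV : IsOpen V)
    (hcomp : IsCompact (⋂ g ∈ GSet S, g • V)) :
    IsOpen (⋂ g ∈ GSet S, g • V) ↔
      ∀ x : X, x ∉ (⋂ g ∈ GSet S, g • V) →
        closure (orbT S x) ∩ (⋂ g ∈ GSet S, g • V) = ∅ := by
  have horb (x : X) : orbT S x = {y | ∃ g ∈ Subgroup.closure S, y = g • x} := by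
    rw [orbT, GSet_eq_closure hid hsymm]
    rfl
  simp only [GSet_eq_closure hid hsymm] at hcomp ⊢
  have hmem := mem_iInter_smul_subgroup (Subgroup.closure S) V
  set K : Set X := ⋂ g ∈ (Subgroup.closure S : Set (X ≃ₜ X)), g • V
  have hinv : ∀ x ∈ K, ∀ g ∈ Subgroup.closure S, g • x ∈ K := fun x hx g hg =>
    (hmem _).2 fun k hk => by
      rw [← mul_smul]
      exact (hmem x).1 hx _ (mul_mem hk hg)
  constructor
  · intro hK x hx
    have hsub : closure (orbT S x) ⊆ Kᶜ := by
      refine closure_minimal ?_ hK.isClosed_compl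
      rw [horb]
      rintro y ⟨g, hg, rfl⟩ hy
      exact hx (by simpa using hinv _ hy g⁻¹ (inv_mem hg))
    exact (Set.disjoint_left.2 fun y hy => hsub hy).inter_eq
  · intro horbit
    have hKV : K ⊆ V := fun x hx => by simpa using (hmem x).1 hx 1 (one_mem _)
    obtain ⟨U, hU, hUc, hKU, hUV⟩ := exists_isClopen_isCompact_between hzero hcomp hV hKV
    set P := allImagesIn S
    set T := someImageIn S U
    have hPanti : Antitone fun n => P^[n] U := antitone_iterate_allImagesIn hid U
    have hPU (n : ℕ) : P^[n] U ⊆ U := hPanti (Nat.zero_le n)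
    have hPclopen (n : ℕ) : IsClopen (P^[n] U) ∧ IsCompact (P^[n] U) := by
      induction n with
      | zero => exact ⟨hU, hUc⟩
      | succ n ih =>
        have h : IsClopen (P^[n + 1] U) := by
          rw [Function.iterate_succ_apply']
          exact isClopen_allImagesIn hequi ih.1 ih.2
        exact ⟨h, hUc.of_isClosed_subset h.isClosed (hPU _)⟩
    have hTclopen (n : ℕ) {A : Set X} (hA : IsClopen A) (hAc : IsCompact A) :
        IsClopen (T^[n] A) ∧ IsCompact (T^[n] A) := by
      induction n with
      | zero => exact ⟨hA, hAc⟩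
      | succ n ih =>
        rw [Function.iterate_succ_apply']
        have h : IsClopen (T (T^[n] A)) := isClopen_someImageIn hequi hU ih.1 ih.2
        exact ⟨h, hUc.of_isClosed_subset h.isClosed fun x hx => hx.1⟩
    have hKP (n : ℕ) : K ⊆ P^[n] U := fun x hx =>
      mem_iterate_allImagesIn (fun g hg => hKU (hinv x hx g hg)) n
    have hPK : ∀ x, (∀ n, x ∈ P^[n] U) → x ∈ K := fun x hx => (hmem x).2 fun g hg =>
      hUV (smul_mem_of_forall_mem_iterate_allImagesIn hsymm hx hg)
    have hTanti : Antitone fun n => T^[n] (P^[n] U) := antitone_iterate_someImageIn hsymm U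
    by_cases hne : ∃ n, T^[n] (P^[n] U) ⊆ P U
    · obtain ⟨n, hn⟩ := hne
      have hstable (k : ℕ) : P^[n] U ⊆ P^[n + k] U := by
        induction k with
        | zero => exact subset_rfl
        | succ k ih =>
          have h := subset_iterate_allImagesIn hid hsymm (n + k) (subset_refl (P^[n + k] U))
            ((hTanti (Nat.le_add_right n k)).trans hn)
          rw [← add_assoc, Function.iterate_succ_apply]
          exact ih.trans h
      have hKeq : K = P^[n] U := (hKP n).antisymm fun x hx => hPK x fun k =>
        hPanti (Nat.le_add_left k n) (hstable k hx)
      rw [hKeq]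
      exact (hPclopen n).1.isOpen
    · push Not at hne
      have hPUopen : IsOpen (P U) := (hPclopen 1).1.isOpen
      have hTc (n : ℕ) := hTclopen n (hPclopen n).1 (hPclopen n).2
      obtain ⟨y, hy⟩ := IsCompact.nonempty_iInter_of_sequence_nonempty_isCompact_isClosed
        (fun n => T^[n] (P^[n] U) \ P U)
        (fun n => Set.sdiff_subset_sdiff_left (hTanti n.le_succ))
        (fun n => Set.sdiff_nonempty.2 (hne n))
        ((hTc 0).2.diff hPUopen) (fun n => (hTc n).1.isClosed.sdiff hPUopen)
      rw [Set.mem_iInter] at hy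
      have hyK : y ∉ K := fun h => (hy 0).2 (hKP 1 h)
      obtain ⟨z, hz⟩ := IsCompact.nonempty_iInter_of_sequence_nonempty_isCompact_isClosed
        (fun n => closure (orbT S y) ∩ P^[n] U)
        (fun n => Set.inter_subset_inter_right _ (hPanti n.le_succ))
        (fun n => by
          obtain ⟨g, hg, hgy⟩ := exists_smul_mem_of_mem_iterate_someImageIn n (hy n).1
          exact ⟨g • y, subset_closure (by rw [horb]; exact ⟨g, hg, rfl⟩), hgy⟩)
        ((hPclopen 0).2.inter_left isClosed_closure)
        (fun n => isClosed_closure.inter (hPclopen n).1.isClosed)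
      rw [Set.mem_iInter] at hz
      exact absurd (horbit y hyK)
        (Set.Nonempty.ne_empty ⟨z, (hz 0).1, hPK z fun n => (hz n).2⟩)
end
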